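/- For all natural numbers n and k with 2k ≤ n, the number of Motzkin prefixes of length n and final height n−2k that contain no level steps (i.e., left factors of Dyck paths of length n ending at height n−2k) equals C(n,k) − C(n,k−1), where C(·,·) is the binomial coefficient (with C(n,−1) = 0). -/

import Mathlib

open Finset

inductive Step : Type
  | U | L | D
deriving DecidableEq

instance : Fintype Step where
  elems := {Step.U, Step.L, Step.D}
  complete := by intro x; cases x <;> simp

/-- The vertical displacement of a step: up = +1, level = 0, down = -1. -/
def Step.val : Step → ℤ
  | .U => 1
  | .L => 0
  | .D => -1

/-- The partial sum of the step values of the first `i` steps;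
this is the height at which step `i` starts. -/
def hsum {n : ℕ} (P : Fin n → Step) (i : ℕ) : ℤ :=
  ∑ j ∈ Finset.univ.filter (fun j : Fin n => (j : ℕ) < i), (P j).val

/-- A Motzkin path: all partial sums nonnegative and total sum 0. -/
abbrev IsMotzkin {n : ℕ} (P : Fin n → Step) : Prop :=
  (∀ i : Fin (n+1), 0 ≤ hsum P (i : ℕ)) ∧ hsum P n = 0

/-- A Motzkin prefix of final height `k`: all partial sums nonnegative, total sum `k`. -/
abbrev IsMPrefix {n : ℕ} (P : Fin n → Step) (k : ℕ) : Prop :=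
  (∀ i : Fin (n+1), 0 ≤ hsum P (i : ℕ)) ∧ hsum P n = (k : ℤ)

/-- `[h]_q = 1 + q + ... + q^(h-1)`. -/
def geo {R : Type*} [CommSemiring R] (q : R) (h : ℤ) : R :=
  ∑ i ∈ Finset.range h.toNat, q ^ i

/-- The Gaussian (q-)binomial coefficient, via the q-Pascal recurrence. -/
def qbinom {R : Type*} [CommSemiring R] (q : R) : ℕ → ℕ → R
  | _, 0 => 1
  | 0, _+1 => 0
  | n+1, k+1 => qbinom q n k + q ^ (k+1) * qbinom q n (k+1)

/-- The binomial coefficient with integer lower argument, zero on negative arguments. -/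
def ch (m : ℕ) (j : ℤ) : ℤ := if 0 ≤ j then m.choose j.toNat else 0

theorem hsum_snoc_le {n : ℕ} (P : Fin n → Step) (s : Step) (i : ℕ) (hi : i ≤ n) :
    hsum (Fin.snoc P s : Fin (n+1) → Step) i = hsum P i := by
  unfold hsum
  rw [Finset.sum_filter, Finset.sum_filter, Fin.sum_univ_castSucc]
  simp [Nat.not_lt.mpr hi]

theorem hsum_snoc_last {n : ℕ} (P : Fin n → Step) (s : Step) :
    hsum (Fin.snoc P s : Fin (n+1) → Step) (n+1) = hsum P n + s.val := by
  unfold hsum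
  rw [Finset.sum_filter, Finset.sum_filter, Fin.sum_univ_castSucc]
  simp only [Fin.snoc_castSucc, Fin.snoc_last, Fin.val_castSucc, Fin.val_last, Fin.is_lt, if_true]
  congr 1
  · apply Finset.sum_congr rfl
    intro x _
    rw [if_pos (by omega)]
  · simp

def pset (n : ℕ) (z : ℤ) : Finset (Fin n → Step) :=
  Finset.univ.filter (fun P : Fin n → Step =>
    ((∀ i : Fin (n+1), 0 ≤ hsum P (i : ℕ)) ∧ hsum P n = z) ∧ ∀ i, P i ≠ Step.L)

theorem mem_pset {n : ℕ} {z : ℤ} {P : Fin n → Step} : P ∈ pset n z ↔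
    ((∀ i : Fin (n+1), 0 ≤ hsum P (i : ℕ)) ∧ hsum P n = z) ∧ ∀ i, P i ≠ Step.L := by
  simp [pset]

theorem snoc_mem_pset {n : ℕ} {z : ℤ} (hz : 0 ≤ z) (P : Fin n → Step) (s : Step) :
    (Fin.snoc P s : Fin (n+1) → Step) ∈ pset (n+1) z ↔ P ∈ pset n (z - s.val) ∧ s ≠ Step.L := by
  have h1 : (∀ i : Fin (n+1+1), 0 ≤ hsum (Fin.snoc P s : Fin (n+1) → Step) (i : ℕ)) ↔
      (∀ i : Fin (n+1), 0 ≤ hsum P (i : ℕ)) ∧ 0 ≤ hsum P n + s.val := by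
    rw [Fin.forall_fin_succ', Fin.val_last, hsum_snoc_last]
    refine and_congr (forall_congr' fun i => ?_) Iff.rfl
    rw [Fin.val_castSucc, hsum_snoc_le P s i (by omega)]
  have h2 : (∀ i : Fin (n+1), (Fin.snoc P s : Fin (n+1) → Step) i ≠ Step.L) ↔
      (∀ i, P i ≠ Step.L) ∧ s ≠ Step.L := by
    rw [Fin.forall_fin_succ']
    simp only [Fin.snoc_castSucc, Fin.snoc_last]
  rw [mem_pset, mem_pset, hsum_snoc_last, h1, h2]
  constructor
  · rintro ⟨⟨⟨a, b⟩, c⟩, d, e⟩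
    exact ⟨⟨⟨a, by omega⟩, d⟩, e⟩
  · rintro ⟨⟨⟨a, b⟩, d⟩, e⟩
    exact ⟨⟨⟨a, by omega⟩, by omega⟩, d, e⟩

theorem pset_succ (n : ℕ) (z : ℤ) (hz : 0 ≤ z) :
    (pset (n+1) z).card = (pset n (z-1)).card + (pset n (z+1)).card := by
  have inj : ∀ s : Step, Function.Injective
      (fun P : Fin n → Step => (Fin.snoc P s : Fin (n+1) → Step)) := by
    intro s P Q hPQ
    have := congrArg (fun f : Fin (n+1) → Step => (Fin.init f : Fin n → Step)) hPQ
    simpa using this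
  have key : pset (n+1) z = (pset n (z-1)).image (fun P => (Fin.snoc P Step.U : Fin (n+1) → Step))
      ∪ (pset n (z+1)).image (fun P => (Fin.snoc P Step.D : Fin (n+1) → Step)) := by
    ext Q
    simp only [Finset.mem_union, Finset.mem_image]
    constructor
    · intro h
      rw [← Fin.snoc_init_self Q] at h
      have h2 := (snoc_mem_pset hz (Fin.init Q : Fin n → Step) (Q (Fin.last n))).1 h
      rcases hq : Q (Fin.last n) with _ | _ | _
      · left
        rw [hq] at h2
        refine ⟨_, h2.1, ?_⟩
        rw [← hq]; exact Fin.snoc_init_self Q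
      · exact absurd hq h2.2
      · right
        rw [hq] at h2
        refine ⟨Fin.init Q, by simpa [Step.val] using h2.1, ?_⟩
        rw [← hq]; exact Fin.snoc_init_self Q
    · rintro (⟨P, hP, rfl⟩ | ⟨P, hP, rfl⟩)
      · exact (snoc_mem_pset hz P _).2 ⟨hP, by simp⟩
      · exact (snoc_mem_pset hz P _).2 ⟨by simpa [Step.val] using hP, by simp⟩
  rw [key, Finset.card_union_of_disjoint, Finset.card_image_of_injective _ (inj _),
    Finset.card_image_of_injective _ (inj _)]
  rw [Finset.disjoint_left]
  intro Q h1 h2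
  simp only [Finset.mem_image] at h1 h2
  obtain ⟨P, _, rfl⟩ := h1
  obtain ⟨P', _, h⟩ := h2
  have := congrFun h (Fin.last n)
  simp at this

theorem pset_neg (n : ℕ) (z : ℤ) (hz : z < 0) : (pset n z).card = 0 := by
  rw [Finset.card_eq_zero, Finset.eq_empty_iff_forall_notMem]
  intro P hP
  rw [mem_pset] at hP
  have := hP.1.1 (Fin.last n)
  simp only [Fin.val_last] at this
  omega

theorem ch_neg (n : ℕ) (k : ℤ) (hk : k < 0) : ch n k = 0 := by
  unfold ch; rw [if_neg (by omega)]

theorem ch_nat (n k : ℕ) : ch n (k : ℤ) = n.choose k := by simp [ch]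

theorem ch_succ (n : ℕ) (k : ℤ) : ch (n+1) k = ch n k + ch n (k-1) := by
  rcases lt_or_ge k 0 with h | h
  · rw [ch_neg _ _ h, ch_neg _ _ h, ch_neg _ _ (by omega)]; rfl
  · lift k to ℕ using h
    cases k with
    | zero => rw [ch_neg _ (_ - 1) (by simp), ch_nat, ch_nat]; simp
    | succ m =>
      have : ((m+1 : ℕ) : ℤ) - 1 = (m : ℕ) := by push_cast; ring
      rw [this, ch_nat, ch_nat, ch_nat, Nat.choose_succ_succ]; push_cast; ring

theorem ballot_bd (n : ℕ) (k : ℤ) (hk : 2 * k = n + 1) : ch n k - ch n (k-1) = 0 := by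
  lift k to ℕ using (by omega)
  cases k with
  | zero => omega
  | succ m =>
    have : ((m+1 : ℕ) : ℤ) - 1 = (m : ℕ) := by push_cast; ring
    rw [this, ch_nat, ch_nat, Nat.choose_symm_of_eq_add (show n = (m+1) + m by omega)]
    simp

theorem ballot (n : ℕ) : ∀ k : ℤ, 2 * k ≤ n + 1 →
    ((pset n (n - 2*k)).card : ℤ) = ch n k - ch n (k-1) := by
  induction n with
  | zero =>
    intro k hk
    have hk0 : k ≤ 0 := by push_cast at hk; omega
    rw [ch_neg _ (k-1) (by omega)]
    rcases hk0.lt_or_eq with h | rfl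
    · rw [ch_neg _ _ h]
      have : pset 0 ((0 : ℕ) - 2*k) = ∅ := by
        rw [Finset.eq_empty_iff_forall_notMem]
        intro P hP
        rw [mem_pset] at hP
        have := hP.1.2
        simp [hsum] at this
        omega
      rw [this]; simp
    · have : pset 0 ((0 : ℕ) - 2*0) = Finset.univ := by
        ext P
        rw [mem_pset]
        simp [hsum, eq_iff_true_of_subsingleton]
      rw [this]; simp [ch]
  | succ n ih =>
    intro k hk
    push_cast at hk
    rcases (show 2 * k = n + 1 + 1 ∨ 2 * k ≤ n + 1 by omega) with h | h
    · rw [pset_neg _ _ (by push_cast; omega), ballot_bd _ _ (by push_cast; omega)]; rfl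
    · rw [pset_succ _ _ (by push_cast; omega)]
      have e1 : ((n+1 : ℕ) : ℤ) - 2*k - 1 = n - 2*k := by push_cast; ring
      have e2 : ((n+1 : ℕ) : ℤ) - 2*k + 1 = n - 2*(k-1) := by push_cast; ring
      rw [e1, e2, Nat.cast_add, ih k h, ih (k-1) (by omega), ch_succ, ch_succ]
      ring

/-- Ballot numbers: the number of left factors of Dyck paths of length `n` and
final height `n - 2k` is `C(n,k) - C(n,k-1)`. -/
theorem stmt10 (n k : ℕ) (h : 2*k ≤ n) :
    ((Finset.univ.filter (fun P : Fin n → Step =>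
        IsMPrefix P (n - 2*k) ∧ ∀ i, P i ≠ Step.L)).card : ℤ)
    = ch n (k : ℤ) - ch n ((k : ℤ) - 1) := by
  rw [← ballot n k (by omega)]
  have e : (n : ℤ) - 2 * k = ((n - 2*k : ℕ) : ℤ) := by omega
  rw [e]
  congr 2
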